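/- Let e be the unique rational-valued function on integer partitions satisfying: e((n)) = n² for the one-part partition of n, and e(α) = −∑_i (n/(n−i))·e(α⁻ⁱ) for any partition α of n with more than one part, where the sum is over distinct part sizes i of α and α⁻ⁱ is α with one part of size i removed. Let p(k) denote the number of integer partitions of k (with p(0) = 1). Then for every n ≥ 1, n·∑_{d∣n} d = ∑_α e(α)·∏_{i=1}^{n} p(i)^{α_i}, where α = (1^{α₁}2^{α₂}⋯n^{α_n}) runs through all partitions of n. -/

import Mathlib

/-- Every part of a partition of `n` with more than one part is strictly
smaller than `n`. -/
theorem Nat.Partition.part_lt_of_one_lt_card {n : ℕ} (α : Nat.Partition n)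
    (h : 1 < α.parts.card) {i : ℕ} (hi : i ∈ α.parts) : i < n := by
  have hc := Multiset.cons_erase hi
  have hsum := α.parts_sum
  rw [← hc, Multiset.sum_cons] at hsum
  have hcard : 0 < (α.parts.erase i).card := by
    rw [Multiset.card_pos]
    intro h0
    rw [h0] at hc
    rw [← hc] at h
    simp at h
  obtain ⟨j, hj⟩ := Multiset.card_pos_iff_exists_mem.mp hcard
  have hjpos : 0 < j := α.parts_pos (Multiset.mem_of_mem_erase hj)
  have hjle : j ≤ (α.parts.erase i).sum :=
    Multiset.single_le_sum (fun x _ => Nat.zero_le x) j hj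
  omega

/-- The partition of `n - i` obtained from a partition `α` of `n` by deleting
one part of size `i`. -/
def Nat.Partition.erasePart {n : ℕ} (α : Nat.Partition n) {i : ℕ}
    (hi : i ∈ α.parts) : Nat.Partition (n - i) where
  parts := α.parts.erase i
  parts_pos := fun hj => α.parts_pos (Multiset.mem_of_mem_erase hj)
  parts_sum := by
    have hc := congrArg Multiset.sum (Multiset.cons_erase hi)
    rw [Multiset.sum_cons] at hc
    have hsum := α.parts_sum
    omega

/-- The defining property of the function `e` of Gulbrandsen and Shen:
`e` assigns a rational number to every partition of every positive integer,
the one-part partition `(n)` gets value `n ^ 2`, and for a partition `α` of `n`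
with more than one part, `e α = -∑_i (n / (n - i)) · e (α⁻ⁱ)`, the sum running
over the distinct part sizes `i` of `α`, where `α⁻ⁱ` is `α` with one part of
size `i` deleted. -/
def IsKummerE (e : (n : ℕ+) → Nat.Partition (n : ℕ) → ℚ) : Prop :=
  (∀ n : ℕ+, e n (Nat.Partition.indiscrete (n : ℕ)) = (n : ℚ) ^ 2) ∧
  (∀ (n : ℕ+) (α : Nat.Partition (n : ℕ)) (hα : 1 < α.parts.card),
    e n α = -∑ i ∈ α.parts.toFinset.attach,
      ((n : ℚ) / ((n : ℚ) - ((i : ℕ) : ℚ))) *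
        e ⟨(n : ℕ) - (i : ℕ), by
              have := α.part_lt_of_one_lt_card hα (Multiset.mem_toFinset.mp i.2)
              omega⟩
          (α.erasePart (Multiset.mem_toFinset.mp i.2)))


/-- Partitions of `n` containing a sub-multiset `t` correspond to partitions of `n - t.sum`. -/
theorem Nat.Partition.sum_filter_le_parts (n : ℕ) (t : Multiset ℕ) (ht : ∀ i ∈ t, 0 < i)
    (hn : t.sum ≤ n) (f : Multiset ℕ → ℚ) :
    ∑ α : Nat.Partition n with t ≤ α.parts, f α.parts =
      ∑ β : Nat.Partition (n - t.sum), f (β.parts + t) := by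
  symm
  refine Finset.sum_bij (fun β _ => ⟨β.parts + t, ?_, ?_⟩) ?_ ?_ ?_ ?_
  · intro i hi
    rcases Multiset.mem_add.mp hi with h | h
    exacts [β.parts_pos h, ht i h]
  · rw [Multiset.sum_add, β.parts_sum]
    omega
  · simp
  · intro β _ γ _ h
    ext1
    simpa using h
  · intro α hα
    have hα : t ≤ α.parts := by simpa using hα
    have hadd := Multiset.sub_add_cancel hα
    refine ⟨⟨α.parts - t, fun hi => α.parts_pos (Multiset.mem_of_le (Multiset.sub_le_self _ _) hi),
      ?_⟩, Finset.mem_univ _, ?_⟩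
    · have := congrArg Multiset.sum hadd
      rw [Multiset.sum_add, α.parts_sum] at this
      omega
    · ext1
      exact hadd
  · intros
    rfl

theorem Nat.Partition.part_le {n : ℕ} (α : Nat.Partition n) {i : ℕ} (hi : i ∈ α.parts) :
    i ≤ n := by
  have := Multiset.single_le_sum (fun x _ => Nat.zero_le x) i hi
  rwa [α.parts_sum] at this

theorem Nat.Partition.toFinset_parts_subset_Icc {n : ℕ} (α : Nat.Partition n) :
    α.parts.toFinset ⊆ Finset.Icc 1 n := fun i hi => by
  have hi := Multiset.mem_toFinset.mp hi
  exact Finset.mem_Icc.mpr ⟨α.parts_pos hi, α.part_le hi⟩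

/-- The divisor sum `σ₁(k)`, written as a double sum over factorisations of `k`. -/
theorem sum_divisors_eq_sum_Icc_mul {n k : ℕ} (hk : k ∈ Finset.Icc 1 n) :
    ∑ d ∈ k.divisors, (d : ℚ) =
      ∑ i ∈ Finset.Icc 1 n, ∑ m ∈ Finset.Icc 1 n, if i * m = k then (i : ℚ) else 0 := by
  obtain ⟨hk1, hkn⟩ := Finset.mem_Icc.mp hk
  have hdiv : k.divisors = {i ∈ Finset.Icc 1 n | i ∣ k} := by
    ext i
    simp only [Nat.mem_divisors, Finset.mem_filter, Finset.mem_Icc]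
    constructor
    · rintro ⟨h, _⟩
      exact ⟨⟨Nat.pos_of_dvd_of_pos h hk1, (Nat.le_of_dvd hk1 h).trans hkn⟩, h⟩
    · rintro ⟨_, h⟩
      exact ⟨h, by omega⟩
  rw [hdiv, Finset.sum_filter]
  refine Finset.sum_congr rfl fun i hi => ?_
  have hi1 : 0 < i := (Finset.mem_Icc.mp hi).1
  split_ifs with h
  · obtain ⟨m, rfl⟩ := h
    have hm : m ∈ Finset.Icc 1 n := by
      rw [Finset.mem_Icc]
      constructor
      · exact Nat.pos_of_mul_pos_left hk1
      · nlinarith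
    simp [Nat.mul_right_inj hi1.ne', hm]
  · refine (Finset.sum_eq_zero fun m _ => if_neg ?_).symm
    rintro rfl
    exact h (dvd_mul_right i m)

theorem Nat.Partition.sum_mul_count {n : ℕ} (α : Nat.Partition n) :
    (n : ℚ) = ∑ i ∈ Finset.Icc 1 n, ∑ m ∈ Finset.Icc 1 n,
      if Multiset.replicate m i ≤ α.parts then (i : ℚ) else 0 := by
  have hsum : n = ∑ i ∈ Finset.Icc 1 n, α.parts.count i * i := by
    conv_lhs => rw [← α.parts_sum, Finset.sum_multiset_count]
    simp only [smul_eq_mul]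
    refine Finset.sum_subset α.toFinset_parts_subset_Icc fun i _ hi => ?_
    rw [Multiset.count_eq_zero.mpr (by simpa using hi), zero_mul]
  have hsum' : (n : ℚ) = ∑ i ∈ Finset.Icc 1 n, (α.parts.count i * i : ℚ) := by
    exact_mod_cast hsum
  rw [hsum']
  refine Finset.sum_congr rfl fun i hi => ?_
  have hi1 : 0 < i := (Finset.mem_Icc.mp hi).1
  have hle : α.parts.count i ≤ n := by
    have h1 : α.parts.count i * i ≤ n := by
      conv_rhs => rw [hsum]
      exact Finset.single_le_sum (f := fun j => α.parts.count j * j)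
        (fun _ _ => Nat.zero_le _) hi
    nlinarith
  have hfilter : {m ∈ Finset.Icc 1 n | Multiset.replicate m i ≤ α.parts} =
      Finset.Icc 1 (α.parts.count i) := by
    ext m
    simp only [Finset.mem_filter, Finset.mem_Icc, ← Multiset.le_count_iff_replicate_le]
    omega
  rw [← Finset.sum_filter, hfilter]
  simp

/-- Euler's recurrence `n p(n) = ∑_{k=1}^n p(n-k) σ₁(k)`. -/
theorem Nat.Partition.mul_card_eq_sum_sigma (n : ℕ) :
    (n : ℚ) * Fintype.card (Nat.Partition n) = ∑ k ∈ Finset.Icc 1 n,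
      (Fintype.card (Nat.Partition (n - k)) : ℚ) * ∑ d ∈ k.divisors, (d : ℚ) := by
  have hinner : ∀ i ∈ Finset.Icc 1 n, ∀ m ∈ Finset.Icc 1 n,
      (∑ α : Nat.Partition n, if Multiset.replicate m i ≤ α.parts then (i : ℚ) else 0) =
      ∑ k ∈ Finset.Icc 1 n,
        (Fintype.card (Nat.Partition (n - k)) : ℚ) * if i * m = k then (i : ℚ) else 0 := by
    intro i hi m hm
    have hi1 : 0 < i := (Finset.mem_Icc.mp hi).1
    have hm1 : 0 < m := (Finset.mem_Icc.mp hm).1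
    have hts : (Multiset.replicate m i).sum = i * m := by simp [mul_comm]
    rw [← Finset.sum_filter]
    by_cases h : i * m ≤ n
    · rw [Nat.Partition.sum_filter_le_parts n (Multiset.replicate m i)
        (fun j hj => Multiset.eq_of_mem_replicate hj ▸ hi1) (by rwa [hts]) (fun _ => (i : ℚ)), hts]
      have hmem : i * m ∈ Finset.Icc 1 n := Finset.mem_Icc.mpr ⟨Nat.mul_pos hi1 hm1, h⟩
      simp only [mul_ite, mul_zero, Finset.sum_ite_eq, if_pos hmem]
      simp
    · rw [Finset.sum_eq_zero, Finset.sum_eq_zero]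
      · intro k hk
        rw [if_neg, mul_zero]
        rintro rfl
        exact h (Finset.mem_Icc.mp hk).2
      · intro α hα
        refine absurd ?_ h
        have hle : Multiset.replicate m i ≤ α.parts := by simpa using hα
        obtain ⟨u, hu⟩ := Multiset.le_iff_exists_add.mp hle
        have := congrArg Multiset.sum hu
        rw [Multiset.sum_add, hts, α.parts_sum] at this
        omega
  calc (n : ℚ) * Fintype.card (Nat.Partition n)
      = ∑ α : Nat.Partition n, (n : ℚ) := by simp [mul_comm]
    _ = ∑ α : Nat.Partition n, ∑ i ∈ Finset.Icc 1 n, ∑ m ∈ Finset.Icc 1 n,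
          if Multiset.replicate m i ≤ α.parts then (i : ℚ) else 0 :=
        Finset.sum_congr rfl fun α _ => α.sum_mul_count
    _ = ∑ i ∈ Finset.Icc 1 n, ∑ m ∈ Finset.Icc 1 n, ∑ α : Nat.Partition n,
          if Multiset.replicate m i ≤ α.parts then (i : ℚ) else 0 := by
        rw [Finset.sum_comm]
        exact Finset.sum_congr rfl fun i _ => Finset.sum_comm
    _ = ∑ i ∈ Finset.Icc 1 n, ∑ m ∈ Finset.Icc 1 n, ∑ k ∈ Finset.Icc 1 n,
          (Fintype.card (Nat.Partition (n - k)) : ℚ) * if i * m = k then (i : ℚ) else 0 :=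
        Finset.sum_congr rfl fun i hi => Finset.sum_congr rfl fun m hm => hinner i hi m hm
    _ = ∑ k ∈ Finset.Icc 1 n, ∑ i ∈ Finset.Icc 1 n, ∑ m ∈ Finset.Icc 1 n,
          (Fintype.card (Nat.Partition (n - k)) : ℚ) * if i * m = k then (i : ℚ) else 0 := by
        rw [Finset.sum_comm (s := Finset.Icc 1 n) (t := Finset.Icc 1 n)
          (f := fun k i => ∑ m ∈ Finset.Icc 1 n,
            (Fintype.card (Nat.Partition (n - k)) : ℚ) * if i * m = k then (i : ℚ) else 0)]
        exact Finset.sum_congr rfl fun i _ => Finset.sum_comm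
    _ = _ := Finset.sum_congr rfl fun k hk => by
        rw [sum_divisors_eq_sum_Icc_mul hk]
        simp only [Finset.mul_sum]

/-- The normalised function `e(α) / |α|`, as a function on multisets; it is `0` on multisets which
are not partitions of a positive integer. -/
noncomputable def kummerG (e : (n : ℕ+) → Nat.Partition (n : ℕ) → ℚ) (s : Multiset ℕ) : ℚ :=
  open Classical in
  if h : 0 < s.sum ∧ ∀ {i}, i ∈ s → 0 < i then e ⟨s.sum, h.1⟩ ⟨s, h.2, rfl⟩ / s.sum else 0

theorem eq_mul_kummerG (e : (n : ℕ+) → Nat.Partition (n : ℕ) → ℚ) {n : ℕ} (hn : 0 < n)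
    (α : Nat.Partition n) : e ⟨n, hn⟩ α = n * kummerG e α.parts := by
  obtain ⟨s, hs, rfl⟩ := α
  have h0 : (s.sum : ℚ) ≠ 0 := by exact_mod_cast hn.ne'
  rw [kummerG, dif_pos ⟨hn, hs⟩, mul_div_cancel₀ _ h0]
  rfl

theorem IsKummerE.kummerG_singleton {e : (n : ℕ+) → Nat.Partition (n : ℕ) → ℚ} (he : IsKummerE e)
    {n : ℕ} (hn : 0 < n) : kummerG e {n} = n := by
  have h := (eq_mul_kummerG e hn (Nat.Partition.indiscrete n)).symm.trans (he.1 ⟨n, hn⟩)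
  have h0 : (n : ℚ) ≠ 0 := by exact_mod_cast hn.ne'
  simp only [PNat.mk_coe, Nat.Partition.indiscrete_parts hn.ne', sq] at h
  exact mul_left_cancel₀ h0 h

theorem IsKummerE.kummerG_parts {e : (n : ℕ+) → Nat.Partition (n : ℕ) → ℚ} (he : IsKummerE e)
    {n : ℕ} (hn : 0 < n) (α : Nat.Partition n) (hα : 1 < α.parts.card) :
    kummerG e α.parts = -∑ i ∈ α.parts.toFinset, kummerG e (α.parts.erase i) := by
  have h := he.2 ⟨n, hn⟩ α hα
  have h0 : (n : ℚ) ≠ 0 := by exact_mod_cast hn.ne'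
  rw [eq_mul_kummerG e] at h
  refine mul_left_cancel₀ h0 (h.trans ?_)
  rw [mul_neg, Finset.mul_sum, ← Finset.sum_attach α.parts.toFinset]
  congr 1
  refine Finset.sum_congr rfl fun i _ => ?_
  have hlt : (i : ℕ) < n := α.part_lt_of_one_lt_card hα (Multiset.mem_toFinset.mp i.2)
  rw [eq_mul_kummerG e]
  have h1 : (n : ℚ) - (i : ℕ) ≠ 0 := sub_ne_zero.mpr (by exact_mod_cast hlt.ne')
  simp only [PNat.mk_coe, Nat.cast_sub hlt.le, Nat.Partition.erasePart]
  field_simp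

theorem Nat.Partition.prod_pow_count {n : ℕ} (α : Nat.Partition n) (p : ℕ → ℚ) :
    ∏ i ∈ Finset.Icc 1 n, p i ^ α.parts.count i = (α.parts.map p).prod := by
  rw [Finset.prod_multiset_map_count]
  refine (Finset.prod_subset α.toFinset_parts_subset_Icc fun i _ hi => ?_).symm
  rw [Multiset.count_eq_zero.mpr (by simpa using hi), pow_zero]

/-- The weighted sums of `kummerG` are the coefficients of the logarithmic derivative of the
generating function of the weights. -/
theorem IsKummerE.sum_kummerG_mul_prod {e : (n : ℕ+) → Nat.Partition (n : ℕ) → ℚ}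
    (he : IsKummerE e) (p : ℕ → ℚ) {n : ℕ} (hn : 0 < n) :
    ∑ α : Nat.Partition n, kummerG e α.parts * (α.parts.map p).prod =
      n * p n - ∑ i ∈ Finset.Icc 1 (n - 1), p i *
        ∑ β : Nat.Partition (n - i), kummerG e β.parts * (β.parts.map p).prod := by
  have hpt : ∀ α : Nat.Partition n, kummerG e α.parts * (α.parts.map p).prod =
      (if α = Nat.Partition.indiscrete n then n * p n else 0) -
      ∑ i ∈ Finset.Icc 1 (n - 1), if {i} ≤ α.parts then
        p i * (kummerG e (α.parts - {i}) * ((α.parts - {i}).map p).prod) else 0 := by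
    intro α
    simp only [Multiset.singleton_le, Multiset.sub_singleton]
    by_cases hα : α = Nat.Partition.indiscrete n
    · rw [if_pos hα, Finset.sum_eq_zero, sub_zero, hα, Nat.Partition.indiscrete_parts hn.ne',
        he.kummerG_singleton hn, Multiset.map_singleton, Multiset.prod_singleton]
      intro i hi
      rw [if_neg]
      rw [hα, Nat.Partition.indiscrete_parts hn.ne', Multiset.mem_singleton]
      have := Finset.mem_Icc.mp hi
      omega
    · have hcard : 1 < α.parts.card := by
        by_contra! hle
        refine hα ?_
        have hsum := α.parts_sum
        ext1
        rw [Nat.Partition.indiscrete_parts hn.ne']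
        interval_cases hc : α.parts.card
        · rw [Multiset.card_eq_zero.mp hc, Multiset.sum_zero] at hsum
          omega
        · obtain ⟨a, ha⟩ := Multiset.card_eq_one.mp hc
          rw [ha, Multiset.sum_singleton] at hsum
          rw [ha, hsum]
      have hfilter : {i ∈ Finset.Icc 1 (n - 1) | i ∈ α.parts} = α.parts.toFinset := by
        ext i
        simp only [Finset.mem_filter, Finset.mem_Icc, Multiset.mem_toFinset, and_iff_right_iff_imp]
        intro hi
        have := α.part_lt_of_one_lt_card hcard hi
        have := α.parts_pos hi
        omega
      rw [if_neg hα, zero_sub, ← Finset.sum_filter, hfilter, he.kummerG_parts hn α hcard,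
        neg_mul, Finset.sum_mul]
      congr 1
      refine Finset.sum_congr rfl fun i hi => ?_
      rw [← Multiset.prod_map_erase (Multiset.mem_toFinset.mp hi)]
      ring
  rw [Finset.sum_congr rfl fun α _ => hpt α, Finset.sum_sub_distrib, Finset.sum_comm]
  simp only [Finset.sum_ite_eq', Finset.mem_univ, if_true]
  congr 1
  refine Finset.sum_congr rfl fun i hi => ?_
  obtain ⟨hi1, hi2⟩ := Finset.mem_Icc.mp hi
  rw [← Finset.sum_filter, Nat.Partition.sum_filter_le_parts n {i} (fun j hj => Multiset.mem_singleton.mp hj ▸ hi1)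
    (by rw [Multiset.sum_singleton]; omega)
    (fun s => p i * (kummerG e (s - {i}) * ((s - {i}).map p).prod)), Finset.mul_sum]
  simp only [add_tsub_cancel_right]
  rfl

theorem IsKummerE.sum_kummerG_mul_prod_card {e : (n : ℕ+) → Nat.Partition (n : ℕ) → ℚ}
    (he : IsKummerE e) (n : ℕ) (hn : 0 < n) :
    ∑ α : Nat.Partition n, kummerG e α.parts *
      (α.parts.map fun i => (Fintype.card (Nat.Partition i) : ℚ)).prod =
      ∑ d ∈ n.divisors, (d : ℚ) := by
  induction n using Nat.strong_induction_on with
  | _ n ih =>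
    rw [he.sum_kummerG_mul_prod (fun i => (Fintype.card (Nat.Partition i) : ℚ)) hn,
      Nat.Partition.mul_card_eq_sum_sigma, sub_eq_iff_eq_add]
    obtain ⟨n, rfl⟩ : ∃ m, n = m + 1 := ⟨n - 1, by omega⟩
    rw [Finset.sum_Icc_succ_top (by omega), add_comm]
    congr 1
    · simp
    · rw [Nat.add_sub_cancel]
      refine Finset.sum_bij' (fun i _ => n + 1 - i) (fun i _ => n + 1 - i) ?_ ?_ ?_ ?_ ?_
      all_goals
        intro i hi
        obtain ⟨hi1, hi2⟩ := Finset.mem_Icc.mp hi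
      · simp only [Finset.mem_Icc]; omega
      · simp only [Finset.mem_Icc]; omega
      · omega
      · omega
      · have : n + 1 - (n + 1 - i) = i := by omega
        rw [ih (n + 1 - (n + 1 - i)) (by omega) (by omega), this]

/-- The combinatorial formula of Gulbrandsen:
`n ∑_{d ∣ n} d = ∑_α e(α) p(1)^{α_1} ⋯ p(n)^{α_n}`, where `α` runs over all
partitions of `n` and `p(i)` is the number of partitions of `i`. -/
theorem sigma_one_eq_sum_kummerE
    (e : (n : ℕ+) → Nat.Partition (n : ℕ) → ℚ) (he : IsKummerE e) :
    ∀ (n : ℕ) (hn : 0 < n),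
      (n : ℚ) * ∑ d ∈ n.divisors, (d : ℚ) =
        ∑ α : Nat.Partition n, e ⟨n, hn⟩ α *
          ∏ i ∈ Finset.Icc 1 n,
            (Fintype.card (Nat.Partition i) : ℚ) ^ α.parts.count i := by
  intro n hn
  rw [← he.sum_kummerG_mul_prod_card n hn, Finset.mul_sum]
  refine Finset.sum_congr rfl fun α _ => ?_
  rw [eq_mul_kummerG e, α.prod_pow_count fun i => (Fintype.card (Nat.Partition i) : ℚ), mul_assoc]
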